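/- Let $(\Omega,\mathcal{F},\mu;(\mathcal{F}_i)_{i\in\mathbb{Z}})$ be a $\sigma$-finite filtered measure space, $s > 1$, $w$ a nonnegative weight, and $\alpha_i$ nonnegative bounded $\mathcal{F}_i$-measurable functions, with only finitely many $\alpha_i$ nonzero and $w$ bounded and integrable. Then $\int_\Omega \big(\sum_{i} \alpha_i \mathcal{E}_i w\big)^s d\mu \leq C \int_\Omega \sum_i \alpha_i \mathcal{E}_i w\, \big(\mathcal{E}_i(\overline{\alpha}_i w)\big)^{s-1} d\mu$, where $\overline{\alpha}_i := \sum_{j\geq i}\alpha_j$, and $C$ depends only on $s$. -/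

import Mathlib

open MeasureTheory
open scoped ENNReal

lemma pow_incr (p : ℝ) (hp : 1 ≤ p) (u v : ℝ) (hu : 0 ≤ u) (hv : 0 ≤ v) :
    (u + v) ^ p ≤ u ^ p + p * (v * (u + v) ^ (p - 1)) := by
  rcases eq_or_lt_of_le (add_nonneg hu hv) with h | h
  · have h1 : u = 0 := by linarith
    have h2 : v = 0 := by linarith
    subst h1; subst h2; simp
  · have hb := one_add_mul_self_le_rpow_one_add (s := -(v / (u + v))) (p := p)
      (by rw [neg_le_neg_iff, div_le_one h]; linarith) hp
    have e : 1 + -(v / (u + v)) = u / (u + v) := by field_simp; ring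
    rw [e, Real.div_rpow hu h.le, le_div_iff₀ (Real.rpow_pos_of_pos h p)] at hb
    have e2 : (u + v) ^ p = (u + v) ^ (p - 1) * (u + v) := by
      rw [← Real.rpow_add_one h.ne']; ring_nf
    have e3 : v / (u + v) * (u + v) ^ p = v * (u + v) ^ (p - 1) := by
      rw [e2]; field_simp
    nlinarith [hb, e3]

lemma sum_le_max (p : ℝ) (hp : 1 ≤ p) (a : ℤ → ℝ) (ha : ∀ i, 0 ≤ a i) (T : Finset ℤ) :
    (∑ i ∈ T, a i) ^ p ≤ p * ∑ i ∈ T, a i * (∑ j ∈ T with j ≤ i, a j) ^ (p - 1) := by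
  induction T using Finset.induction_on_max with
  | empty => simp [Real.zero_rpow (by linarith : p ≠ 0)]
  | insert m S hm ih =>
    have hmS : m ∉ S := fun h => lt_irrefl _ (hm m h)
    rw [Finset.sum_insert hmS, Finset.sum_insert hmS, mul_add]
    have e1 : (insert m S).filter (· ≤ m) = insert m S := by
      apply Finset.filter_true_of_mem
      intro x hx
      rcases Finset.mem_insert.1 hx with h | h
      · exact h.le
      · exact (hm x h).le
    have e2 : ∀ i ∈ S, (insert m S).filter (· ≤ i) = S.filter (· ≤ i) := by
      intro i hi
      rw [Finset.filter_insert, if_neg (not_le.2 (hm i hi))]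
    rw [e1, Finset.sum_insert hmS]
    have e3 : ∑ i ∈ S, a i * (∑ j ∈ insert m S with j ≤ i, a j) ^ (p - 1)
        = ∑ i ∈ S, a i * (∑ j ∈ S with j ≤ i, a j) ^ (p - 1) :=
      Finset.sum_congr rfl fun i hi => by rw [e2 i hi]
    rw [e3]
    have := pow_incr p hp (∑ i ∈ S, a i) (a m) (Finset.sum_nonneg fun i _ => ha i) (ha m)
    rw [add_comm (a m)]
    linarith

lemma sum_le_min (p : ℝ) (hp : 1 ≤ p) (a : ℤ → ℝ) (ha : ∀ i, 0 ≤ a i) (T : Finset ℤ) :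
    (∑ i ∈ T, a i) ^ p ≤ p * ∑ i ∈ T, a i * (∑ j ∈ T with i ≤ j, a j) ^ (p - 1) := by
  induction T using Finset.induction_on_min with
  | empty => simp [Real.zero_rpow (by linarith : p ≠ 0)]
  | insert m S hm ih =>
    have hmS : m ∉ S := fun h => lt_irrefl _ (hm m h)
    rw [Finset.sum_insert hmS, Finset.sum_insert hmS, mul_add]
    have e1 : (insert m S).filter (m ≤ ·) = insert m S := by
      apply Finset.filter_true_of_mem
      intro x hx
      rcases Finset.mem_insert.1 hx with h | h
      · exact h.ge
      · exact (hm x h).le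
    have e2 : ∀ i ∈ S, (insert m S).filter (i ≤ ·) = S.filter (i ≤ ·) := by
      intro i hi
      rw [Finset.filter_insert, if_neg (not_le.2 (hm i hi))]
    rw [e1, Finset.sum_insert hmS]
    have e3 : ∑ i ∈ S, a i * (∑ j ∈ insert m S with i ≤ j, a j) ^ (p - 1)
        = ∑ i ∈ S, a i * (∑ j ∈ S with i ≤ j, a j) ^ (p - 1) :=
      Finset.sum_congr rfl fun i hi => by rw [e2 i hi]
    rw [e3]
    have := pow_incr p hp (∑ i ∈ S, a i) (a m) (Finset.sum_nonneg fun i _ => ha i) (ha m)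
    rw [add_comm (a m)]
    linarith

lemma sum_double (s : ℝ) (hs : 2 < s) (a : ℤ → ℝ) (ha : ∀ i, 0 ≤ a i) (T : Finset ℤ) :
    (∑ i ∈ T, a i) ^ s ≤ (s * (s - 1)) * ∑ i ∈ T, (a i * (∑ j ∈ T with j ≤ i, a j) ^ (s - 2)) *
      (∑ j ∈ T with i ≤ j, a j) := by
  refine (sum_le_max s (by linarith) a ha T).trans ?_
  rw [mul_assoc]
  refine mul_le_mul_of_nonneg_left ?_ (by linarith)
  have h1 : ∀ k ∈ T, a k * (∑ j ∈ T with j ≤ k, a j) ^ (s - 1) ≤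
      (s - 1) * ∑ j ∈ T with j ≤ k, a k * (a j * (∑ l ∈ T with l ≤ j, a l) ^ (s - 2)) := by
    intro k _
    have := sum_le_max (s - 1) (by linarith) a ha (T.filter (· ≤ k))
    rw [← Finset.mul_sum, mul_left_comm]
    refine mul_le_mul_of_nonneg_left (this.trans_eq ?_) (ha k)
    congr 1
    refine Finset.sum_congr rfl fun j hj => ?_
    have hjk := (Finset.mem_filter.1 hj).2
    have : (T.filter (· ≤ k)).filter (· ≤ j) = T.filter (· ≤ j) := by
      ext x; simp only [Finset.mem_filter]; constructor
      · rintro ⟨⟨h, _⟩, h'⟩; exact ⟨h, h'⟩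
      · rintro ⟨h, h'⟩; exact ⟨⟨h, h'.trans hjk⟩, h'⟩
    rw [this]; congr 2; ring
  refine (Finset.sum_le_sum h1).trans_eq ?_
  rw [← Finset.mul_sum]
  congr 1
  simp only [Finset.sum_filter, Finset.mul_sum]
  rw [Finset.sum_comm]
  refine Finset.sum_congr rfl fun j _ => Finset.sum_congr rfl fun k _ => ?_
  split_ifs <;> ring

lemma young (s e x y : ℝ) (hs : 2 < s) (he : 0 < e) (hx : 0 ≤ x) (hy : 0 ≤ y) :
    x ^ (s - 2) * y ≤ e * x ^ (s - 1) + (e⁻¹) ^ (s - 2) * y ^ (s - 1) := by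
  have hX : x ^ (s - 1) = x ^ (s - 2) * x := by
    rw [← Real.rpow_add_one' hx (by linarith)]; ring_nf
  have hY : y ^ (s - 1) = y ^ (s - 2) * y := by
    rw [← Real.rpow_add_one' hy (by linarith)]; ring_nf
  rcases le_total y (e * x) with h | h
  · have : 0 ≤ (e⁻¹) ^ (s - 2) * y ^ (s - 1) := by positivity
    have : x ^ (s - 2) * y ≤ x ^ (s - 2) * (e * x) := by gcongr
    rw [hX]; linarith
  · have h0 : 0 ≤ e * x ^ (s - 1) := by positivity
    have h1 : x ≤ e⁻¹ * y := by rw [inv_mul_eq_div, le_div_iff₀ he]; linarith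
    have : x ^ (s - 2) ≤ (e⁻¹ * y) ^ (s - 2) := Real.rpow_le_rpow hx h1 (by linarith)
    rw [Real.mul_rpow (by positivity) hy] at this
    have := mul_le_mul_of_nonneg_right this hy
    rw [hY]; linarith

lemma tang (s R y : ℝ) (hs : 1 < s) (hs2 : s ≤ 2) (hR : 0 ≤ R) (hy : 0 < y) :
    R ^ (s - 1) ≤ y ^ (s - 2) * R + y ^ (s - 1) := by
  rcases le_total R y with h | h
  · have := Real.rpow_le_rpow hR h (by linarith : 0 ≤ s - 1)
    have : 0 ≤ y ^ (s - 2) * R := by positivity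
    linarith
  · have hX : R ^ (s - 1) = R ^ (s - 2) * R := by
      rw [← Real.rpow_add_one' hR (by linarith)]; ring_nf
    have := Real.rpow_le_rpow_of_nonpos hy h (by linarith : s - 2 ≤ 0)
    have := mul_le_mul_of_nonneg_right this hR
    have : 0 ≤ y ^ (s - 1) := by positivity
    linarith

section core
variable {Ω : Type} {m0 : MeasurableSpace Ω} {μ : Measure Ω}

lemma int_pow (T : Finset ℤ) (a : ℤ → Ω → ℝ) (B s : ℝ) (hs : 1 < s)
    (ha0 : ∀ i x, 0 ≤ a i x) (haB : ∀ i x, a i x ≤ B) (hai : ∀ i, Integrable (a i) μ) :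
    Integrable (fun x => (∑ i ∈ T, a i x) ^ s) μ := by
  have hS : Integrable (fun x => ∑ i ∈ T, a i x) μ := integrable_finsetSum _ fun i _ => hai i
  have h0 : ∀ x, 0 ≤ ∑ i ∈ T, a i x := fun x => Finset.sum_nonneg fun i _ => ha0 i x
  have := hS.mul_bdd (g := fun x => (∑ i ∈ T, a i x) ^ (s - 1)) (c := (∑ i ∈ T, B) ^ (s - 1))
    ((hS.1.aemeasurable.pow_const _).aestronglyMeasurable)
    (Filter.Eventually.of_forall fun x => by
      rw [Real.norm_of_nonneg (Real.rpow_nonneg (h0 x) _)]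
      exact Real.rpow_le_rpow (h0 x) (Finset.sum_le_sum fun i _ => haB i x) (by linarith))
  refine this.congr (Filter.Eventually.of_forall fun x => ?_)
  simp only
  rw [mul_comm, ← Real.rpow_add_one' (h0 x) (by linarith)]; ring_nf

lemma int_ay (a y : Ω → ℝ) (B s : ℝ) (hs : 1 < s) (hai : Integrable a μ)
    (hym : AEStronglyMeasurable y μ) (hy0 : ∀ x, 0 ≤ y x) (hyB : ∀ x, y x ≤ B) :
    Integrable (fun x => a x * y x ^ (s - 1)) μ :=
  hai.mul_bdd (c := B ^ (s - 1)) (hym.aemeasurable.pow_const _).aestronglyMeasurable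
    (Filter.Eventually.of_forall fun x => by
      rw [Real.norm_of_nonneg (Real.rpow_nonneg (hy0 x) _)]
      exact Real.rpow_le_rpow (hy0 x) (hyB x) (by linarith))

lemma core_small (s : ℝ) (hs : 1 < s) (hs2 : s ≤ 2) (ℱ : Filtration ℤ m0) (T : Finset ℤ)
    (a y : ℤ → Ω → ℝ) (B : ℝ) (ham : ∀ i, StronglyMeasurable[ℱ i] (a i))
    (ha0 : ∀ i x, 0 ≤ a i x) (haB : ∀ i x, a i x ≤ B) (hai : ∀ i, Integrable (a i) μ)
    (hym : ∀ i, StronglyMeasurable[ℱ i] (y i))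
    (hy0 : ∀ i x, 0 ≤ y i x) (hyB : ∀ i x, y i x ≤ B)
    (hay : ∀ i ∈ T, ∀ᵐ x ∂μ, a i x ≤ y i x)
    (hkey : ∀ i ∈ T, ∀ f : Ω → ℝ, StronglyMeasurable[ℱ i] f → (∃ c, ∀ᵐ x ∂μ, ‖f x‖ ≤ c) →
      ∫ x, f x * ∑ j ∈ T with i ≤ j, a j x ∂μ = ∫ x, f x * y i x ∂μ) :
    ∫ x, (∑ i ∈ T, a i x) ^ s ∂μ ≤ (2 * s) * ∫ x, ∑ i ∈ T, a i x * y i x ^ (s - 1) ∂μ := by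
  have hR : ∀ i, Integrable (fun x => ∑ j ∈ T with i ≤ j, a j x) μ := fun i =>
    integrable_finsetSum _ fun j _ => hai j
  have hR0 : ∀ i x, 0 ≤ ∑ j ∈ T with i ≤ j, a j x := fun i x =>
    Finset.sum_nonneg fun j _ => ha0 j x
  have hI2 : ∀ i ∈ T, Integrable (fun x => a i x * y i x ^ (s - 1)) μ := fun i _ =>
    int_ay _ _ B s hs (hai i) ((hym i).mono (ℱ.le i)).aestronglyMeasurable (hy0 i) (hyB i)
  have hfm : ∀ i, StronglyMeasurable[ℱ i] (fun x => a i x * y i x ^ (s - 2)) := fun i =>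
    ((ham i).measurable.mul ((hym i).measurable.pow_const _)).stronglyMeasurable
  have hfb : ∀ i ∈ T, ∀ᵐ x ∂μ, ‖a i x * y i x ^ (s - 2)‖ ≤ B ^ (s - 1) := by
    intro i hi
    filter_upwards [hay i hi] with x hx
    rw [Real.norm_of_nonneg (mul_nonneg (ha0 i x) (Real.rpow_nonneg (hy0 i x) _))]
    refine le_trans ?_ (Real.rpow_le_rpow (hy0 i x) (hyB i x) (by linarith : 0 ≤ s - 1))
    have e : y i x ^ (s - 1) = y i x ^ (s - 2) * y i x := by
      rw [← Real.rpow_add_one' (hy0 i x) (by linarith)]; ring_nf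
    rw [e, mul_comm]
    exact mul_le_mul_of_nonneg_left hx (Real.rpow_nonneg (hy0 i x) _)
  have hI1 : ∀ i ∈ T, Integrable (fun x => (a i x * y i x ^ (s - 2)) *
      ∑ j ∈ T with i ≤ j, a j x) μ := fun i hi =>
    (hR i).bdd_mul ((hfm i).mono (ℱ.le i)).aestronglyMeasurable (hfb i hi)
  have hI12 : ∀ i ∈ T, Integrable (fun x => (a i x * y i x ^ (s - 2)) *
      (∑ j ∈ T with i ≤ j, a j x) + a i x * y i x ^ (s - 1)) μ := fun i hi =>
    (hI1 i hi).add (hI2 i hi)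
  have hay' : ∀ᵐ x ∂μ, ∀ i ∈ T, a i x ≤ y i x :=
    (Filter.eventually_all_finset T).2 hay
  have step1 : ∫ x, (∑ i ∈ T, a i x) ^ s ∂μ ≤ ∫ x, s * ∑ i ∈ T,
      ((a i x * y i x ^ (s - 2)) * (∑ j ∈ T with i ≤ j, a j x) + a i x * y i x ^ (s - 1)) ∂μ := by
    refine integral_mono_of_nonneg (Filter.Eventually.of_forall fun x =>
      Real.rpow_nonneg (Finset.sum_nonneg fun i _ => ha0 i x) _) ?_ ?_
    · exact (integrable_finsetSum _ fun i hi => (hI1 i hi).add (hI2 i hi)).const_mul s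
    · filter_upwards [hay'] with x hx
      refine (sum_le_min s hs.le (fun i => a i x) (fun i => ha0 i x) T).trans ?_
      refine mul_le_mul_of_nonneg_left (Finset.sum_le_sum fun i hi => ?_) (by linarith)
      rcases eq_or_lt_of_le (ha0 i x) with h | h
      · simp [← h]
      · have := tang s _ (y i x) hs hs2 (hR0 i x) (h.trans_le (hx i hi))
        have := mul_le_mul_of_nonneg_left this h.le
        linarith
  refine step1.trans_eq ?_
  rw [integral_const_mul, integral_finsetSum _ hI12,
    integral_finsetSum _ hI2]
  have : ∀ i ∈ T, ∫ x, ((a i x * y i x ^ (s - 2)) * (∑ j ∈ T with i ≤ j, a j x)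
      + a i x * y i x ^ (s - 1)) ∂μ = 2 * ∫ x, a i x * y i x ^ (s - 1) ∂μ := by
    intro i hi
    rw [integral_add (hI1 i hi) (hI2 i hi), hkey i hi _ (hfm i) ⟨_, hfb i hi⟩, two_mul]
    congr 2
    ext x
    rw [mul_assoc, ← Real.rpow_add_one' (hy0 i x) (by linarith)]; ring_nf
  rw [Finset.sum_congr rfl this, ← Finset.mul_sum]; ring

lemma core_big (s : ℝ) (hs : 2 < s) (ℱ : Filtration ℤ m0) (T : Finset ℤ)
    (a y : ℤ → Ω → ℝ) (B : ℝ) (ham : ∀ i, StronglyMeasurable[ℱ i] (a i))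
    (ha0 : ∀ i x, 0 ≤ a i x) (haB : ∀ i x, a i x ≤ B) (hai : ∀ i, Integrable (a i) μ)
    (hym : ∀ i, StronglyMeasurable[ℱ i] (y i)) (hyi : ∀ i, Integrable (y i) μ)
    (hy0 : ∀ i x, 0 ≤ y i x) (hyB : ∀ i x, y i x ≤ B)
    (hkey : ∀ i ∈ T, ∀ f : Ω → ℝ, StronglyMeasurable[ℱ i] f → (∃ c, ∀ᵐ x ∂μ, ‖f x‖ ≤ c) →
      ∫ x, f x * ∑ j ∈ T with i ≤ j, a j x ∂μ = ∫ x, f x * y i x ∂μ) :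
    ∫ x, (∑ i ∈ T, a i x) ^ s ∂μ ≤
      (2 * (s * (s - 1)) * (2 * (s * (s - 1))) ^ (s - 2)) *
        ∫ x, ∑ i ∈ T, a i x * y i x ^ (s - 1) ∂μ := by
  have hK : 0 < s * (s - 1) := mul_pos (by linarith) (by linarith)
  have hS0 : ∀ i x, 0 ≤ ∑ j ∈ T with j ≤ i, a j x := fun i x =>
    Finset.sum_nonneg fun j _ => ha0 j x
  have hR : ∀ i, Integrable (fun x => ∑ j ∈ T with i ≤ j, a j x) μ := fun i =>
    integrable_finsetSum _ fun j _ => hai j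
  have hI2 : ∀ i ∈ T, Integrable (fun x => a i x * y i x ^ (s - 1)) μ := fun i _ =>
    int_ay _ _ B s (by linarith) (hai i) ((hym i).mono (ℱ.le i)).aestronglyMeasurable
      (hy0 i) (hyB i)
  have hfm : ∀ i, StronglyMeasurable[ℱ i]
      (fun x => a i x * (∑ j ∈ T with j ≤ i, a j x) ^ (s - 2)) := by
    intro i
    have h1 : Measurable[ℱ i] (fun x => ∑ j ∈ T with j ≤ i, a j x) :=
      Finset.measurable_fun_sum _ fun j hj =>
        ((ham j).mono (ℱ.mono (Finset.mem_filter.1 hj).2)).measurable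
    exact ((ham i).measurable.mul (h1.pow_const _)).stronglyMeasurable
  have hfb : ∀ i, ∀ᵐ x ∂μ, ‖a i x * (∑ j ∈ T with j ≤ i, a j x) ^ (s - 2)‖ ≤
      B * (∑ j ∈ T with j ≤ i, B) ^ (s - 2) := by
    intro i
    refine Filter.Eventually.of_forall fun x => ?_
    rw [Real.norm_of_nonneg (mul_nonneg (ha0 i x) (Real.rpow_nonneg (hS0 i x) _))]
    exact mul_le_mul (haB i x) (Real.rpow_le_rpow (hS0 i x)
      (Finset.sum_le_sum fun j _ => haB j x) (by linarith)) (Real.rpow_nonneg (hS0 i x) _)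
      ((ha0 i x).trans (haB i x))
  have hI1 : ∀ i ∈ T, Integrable (fun x => (a i x * (∑ j ∈ T with j ≤ i, a j x) ^ (s - 2)) *
      ∑ j ∈ T with i ≤ j, a j x) μ := fun i hi =>
    (hR i).bdd_mul ((hfm i).mono (ℱ.le i)).aestronglyMeasurable (hfb i)
  have hI3 : ∀ i ∈ T, Integrable (fun x => (a i x * (∑ j ∈ T with j ≤ i, a j x) ^ (s - 2)) *
      y i x) μ := fun i hi =>
    (hyi i).bdd_mul ((hfm i).mono (ℱ.le i)).aestronglyMeasurable (hfb i)
  have hA := int_pow (μ := μ) T a B s (by linarith) ha0 haB hai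
  have hA2 := integrable_finsetSum _ hI2
  set K := s * (s - 1) with hKdef
  set D := (2 * K) ^ (s - 2) with hD
  have step1 : ∫ x, (∑ i ∈ T, a i x) ^ s ∂μ ≤ ∫ x, K * ∑ i ∈ T,
      ((a i x * (∑ j ∈ T with j ≤ i, a j x) ^ (s - 2)) * (∑ j ∈ T with i ≤ j, a j x)) ∂μ := by
    refine integral_mono hA ((integrable_finsetSum _ hI1).const_mul K) fun x => ?_
    exact sum_double s hs (fun i => a i x) (fun i => ha0 i x) T
  have step2 : ∫ x, K * ∑ i ∈ T,
      ((a i x * (∑ j ∈ T with j ≤ i, a j x) ^ (s - 2)) * (∑ j ∈ T with i ≤ j, a j x)) ∂μ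
      = ∫ x, K * ∑ i ∈ T, ((a i x * (∑ j ∈ T with j ≤ i, a j x) ^ (s - 2)) * y i x) ∂μ := by
    rw [integral_const_mul, integral_const_mul, integral_finsetSum _ hI1,
      integral_finsetSum _ hI3]
    congr 1
    exact Finset.sum_congr rfl fun i hi => hkey i hi _ (hfm i) ⟨_, hfb i⟩
  have step3 : ∫ x, K * ∑ i ∈ T, ((a i x * (∑ j ∈ T with j ≤ i, a j x) ^ (s - 2)) * y i x) ∂μ
      ≤ ∫ x, (1 / 2 * (∑ i ∈ T, a i x) ^ s +
        (K * D) * ∑ i ∈ T, a i x * y i x ^ (s - 1)) ∂μ := by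
    refine integral_mono ((integrable_finsetSum _ hI3).const_mul K)
      ((hA.const_mul _).add (hA2.const_mul _)) fun x => ?_
    simp only
    have hSx : 0 ≤ ∑ i ∈ T, a i x := Finset.sum_nonneg fun i _ => ha0 i x
    have h1 : ∀ i ∈ T, (a i x * (∑ j ∈ T with j ≤ i, a j x) ^ (s - 2)) * y i x ≤
        (2 * K)⁻¹ * (a i x * (∑ j ∈ T, a j x) ^ (s - 1)) + D * (a i x * y i x ^ (s - 1)) := by
      intro i hi
      have h2 := young s (2 * K)⁻¹ _ (y i x) hs (by positivity) (hS0 i x) (hy0 i x)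
      rw [inv_inv, ← hD] at h2
      have h3 : (∑ j ∈ T with j ≤ i, a j x) ^ (s - 1) ≤ (∑ j ∈ T, a j x) ^ (s - 1) :=
        Real.rpow_le_rpow (hS0 i x) (Finset.sum_le_sum_of_subset_of_nonneg
          (Finset.filter_subset _ _) fun j _ _ => ha0 j x) (by linarith)
      have h4 := mul_le_mul_of_nonneg_left h3 (by positivity : 0 ≤ (2 * K)⁻¹)
      have h5 := mul_le_mul_of_nonneg_left (h2.trans (add_le_add_left h4 _)) (ha0 i x)
      linarith
    have h6 := mul_le_mul_of_nonneg_left (Finset.sum_le_sum h1) hK.le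
    refine h6.trans_eq ?_
    rw [Finset.sum_add_distrib, ← Finset.mul_sum, ← Finset.mul_sum, ← Finset.sum_mul,
      mul_comm (∑ i ∈ T, a i x), ← Real.rpow_add_one' hSx (by linarith), sub_add_cancel]
    field_simp
  rw [integral_add (hA.const_mul _) (hA2.const_mul _), integral_const_mul (1 / 2 : ℝ),
    integral_const_mul (K * D)] at step3
  have := step1.trans (step2.le.trans step3)
  linarith
end core

theorem stmt_5 (s : ℝ) (hs : 1 < s) :
    ∃ C : ℝ, 0 < C ∧
      ∀ (Ω : Type) (m0 : MeasurableSpace Ω) (μ : Measure Ω), SigmaFinite μ →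
      ∀ (ℱ : Filtration ℤ m0), (∀ i, SigmaFinite (μ.trim (ℱ.le i))) →
      ∀ w : Ω → ℝ, Measurable w → (∀ x, 0 ≤ w x) → (∃ M, ∀ x, w x ≤ M) →
        Integrable w μ →
      ∀ α : ℤ → Ω → ℝ, (∀ i, Measurable[ℱ i] (α i)) → (∀ i x, 0 ≤ α i x) →
        (∀ i, ∃ M, ∀ x, α i x ≤ M) → {i | α i ≠ 0}.Finite →
      (∫⁻ x, ENNReal.ofReal ((∑' i : ℤ, α i x * (μ[w|ℱ i]) x) ^ s) ∂μ)
        ≤ ENNReal.ofReal C *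
          ∫⁻ x, ENNReal.ofReal (∑' i : ℤ, α i x * (μ[w|ℱ i]) x *
            ((μ[fun y => (∑' j : {j : ℤ // i ≤ j}, α j.1 y) * w y|ℱ i]) x) ^ (s - 1)) ∂μ := by
  have hcore : ∃ C : ℝ, 0 < C ∧ ∀ (Ω : Type) (m0 : MeasurableSpace Ω) (μ : Measure Ω)
    (ℱ : Filtration ℤ m0) (T : Finset ℤ)
    (a y : ℤ → Ω → ℝ) (B : ℝ) (_ : ∀ i, StronglyMeasurable[ℱ i] (a i))
    (_ : ∀ i x, 0 ≤ a i x) (_ : ∀ i x, a i x ≤ B) (_ : ∀ i, Integrable (a i) μ)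
    (_ : ∀ i, StronglyMeasurable[ℱ i] (y i)) (_ : ∀ i, Integrable (y i) μ)
    (_ : ∀ i x, 0 ≤ y i x) (_ : ∀ i x, y i x ≤ B)
    (_ : ∀ i ∈ T, ∀ᵐ x ∂μ, a i x ≤ y i x)
    (_ : ∀ i ∈ T, ∀ f : Ω → ℝ, StronglyMeasurable[ℱ i] f → (∃ c, ∀ᵐ x ∂μ, ‖f x‖ ≤ c) →
      ∫ x, f x * ∑ j ∈ T with i ≤ j, a j x ∂μ = ∫ x, f x * y i x ∂μ),
    ∫ x, (∑ i ∈ T, a i x) ^ s ∂μ ≤ C * ∫ x, ∑ i ∈ T, a i x * y i x ^ (s - 1) ∂μ := by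
    rcases le_or_gt s 2 with h | h
    · exact ⟨2 * s, by linarith, fun Ω m0 μ ℱ T a y B h1 h2 h3 h4 h5 h6 h7 h8 h9 h10 =>
        core_small s hs h ℱ T a y B h1 h2 h3 h4 h5 h7 h8 h9 h10⟩
    · have hK : 0 < s * (s - 1) := mul_pos (by linarith) (by linarith)
      exact ⟨_, by positivity, fun Ω m0 μ ℱ T a y B h1 h2 h3 h4 h5 h6 h7 h8 h9 h10 =>
        core_big s h ℱ T a y B h1 h2 h3 h4 h5 h6 h7 h8 h10⟩
  obtain ⟨C, hC, hcore⟩ := hcore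
  refine ⟨C, hC, ?_⟩
  intro Ω m0 μ _ ℱ hσ w hwm hw0 ⟨M, hM⟩ hwi α hαm hα0 hαb hfin
  set T := hfin.toFinset with hT
  have hTz : ∀ i, i ∉ T → α i = 0 := by
    intro i hi; by_contra h; exact hi (by simp [hT, h])
  -- uniform bound for α
  obtain ⟨A, hA0, hA⟩ : ∃ A, 0 ≤ A ∧ ∀ i x, α i x ≤ A := by
    choose N hN using hαb
    refine ⟨∑ i ∈ T, |N i|, Finset.sum_nonneg fun i _ => abs_nonneg _, fun i x => ?_⟩
    by_cases hi : i ∈ T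
    · exact (hN i x).trans ((le_abs_self _).trans
        (Finset.single_le_sum (f := fun i => |N i|) (fun i _ => abs_nonneg _) hi))
    · rw [hTz i hi]; exact Finset.sum_nonneg fun i _ => abs_nonneg _
  have hM0 : ∀ x : Ω, 0 ≤ M := fun x => (hw0 x).trans (hM x)
  set N : ℝ := max M 0 with hN
  have hN0 : 0 ≤ N := le_max_right _ _
  have hwN : ∀ x, w x ≤ N := fun x => (hM x).trans (le_max_left _ _)
  -- tail sums
  have htail : ∀ i y, (∑' j : {j : ℤ // i ≤ j}, α j.1 y) = ∑ j ∈ T with i ≤ j, α j y := by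
    intro i y
    have e1 : (∑' j : {j : ℤ // i ≤ j}, α j.1 y) =
        ∑' j : ℤ, Set.indicator {j : ℤ | i ≤ j} (fun j => α j y) j :=
      tsum_subtype {j : ℤ | i ≤ j} (fun j => α j y)
    rw [e1, tsum_eq_sum (s := T), Finset.sum_filter]
    · refine Finset.sum_congr rfl fun j _ => ?_
      simp [Set.indicator]
    · intro j hj
      simp [Set.indicator, hTz j hj]
  have hE : ∀ i, (fun y => (∑' j : {j : ℤ // i ≤ j}, α j.1 y) * w y) =
      ∑ j ∈ T with i ≤ j, (fun y => α j y * w y) := by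
    intro i; ext y; rw [htail, Finset.sum_mul, Finset.sum_apply]
  have hαw : ∀ j, Integrable (fun y => α j y * w y) μ := fun j =>
    hwi.bdd_mul (c := A) ((hαm j).mono (ℱ.le j) le_rfl).aestronglyMeasurable
      (Filter.Eventually.of_forall fun x => by
        rw [Real.norm_of_nonneg (hα0 j x)]; exact hA j x)
  set g : ℤ → Ω → ℝ := fun i => ∑ j ∈ T with i ≤ j, (fun y => α j y * w y) with hg
  have hgi : ∀ i, Integrable (g i) μ := fun i => integrable_finsetSum' _ fun j _ => hαw j
  have hg0 : ∀ i x, 0 ≤ g i x := fun i x => by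
    simp only [hg, Finset.sum_apply]
    exact Finset.sum_nonneg fun j _ => mul_nonneg (hα0 j x) (hw0 x)
  have hgB : ∀ i x, g i x ≤ T.card * (A * N) := fun i x => by
    simp only [hg, Finset.sum_apply]
    calc _ ≤ ∑ j ∈ T, α j x * w x := Finset.sum_le_sum_of_subset_of_nonneg
            (Finset.filter_subset _ _) fun j _ _ => mul_nonneg (hα0 j x) (hw0 x)
      _ ≤ ∑ j ∈ T, A * N := Finset.sum_le_sum fun j _ =>
            mul_le_mul (hA j x) (hwN x) (hw0 x) hA0
      _ = _ := by simp
  -- generic a.e. bounds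
  have hbd : ∀ (f : Ω → ℝ) (c : ℝ), 0 ≤ c → (∀ x, 0 ≤ f x) → (∀ x, f x ≤ c) → ∀ i,
      (fun x => max 0 (min c ((μ[f|ℱ i]) x))) =ᵐ[μ] μ[f|ℱ i] := by
    intro f c hc h0 h1 i
    have k1 : 0 ≤ᵐ[μ] μ[f|ℱ i] := condExp_nonneg (Filter.Eventually.of_forall h0)
    have k2 := ae_bdd_condExp_of_ae_bdd (μ := μ) (m := ℱ i) (R := ⟨c, hc⟩) (f := f)
      (Filter.Eventually.of_forall fun x => by rw [abs_of_nonneg (h0 x)]; exact h1 x)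
    filter_upwards [k1, k2] with x hx1 hx2
    have hx3 : (μ[f|ℱ i]) x ≤ c := (le_abs_self _).trans hx2
    rw [min_eq_right hx3]; exact max_eq_right hx1
  have hBg0 : 0 ≤ (T.card : ℝ) * (A * N) := by positivity
  set W : ℤ → Ω → ℝ := fun i x => max 0 (min N ((μ[w|ℱ i]) x)) with hW
  set y : ℤ → Ω → ℝ := fun i x => max 0 (min (T.card * (A * N)) ((μ[g i|ℱ i]) x)) with hy
  have hWE : ∀ i, W i =ᵐ[μ] μ[w|ℱ i] := hbd w N hN0 hw0 hwN
  have hyE : ∀ i, y i =ᵐ[μ] μ[g i|ℱ i] := fun i => hbd (g i) _ hBg0 (hg0 i) (hgB i) i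
  set a : ℤ → Ω → ℝ := fun i x => α i x * W i x with ha
  have hWm : ∀ i, StronglyMeasurable[ℱ i] (W i) := fun i =>
    (measurable_const.max (measurable_const.min
      stronglyMeasurable_condExp.measurable)).stronglyMeasurable
  have hym : ∀ i, StronglyMeasurable[ℱ i] (y i) := fun i =>
    (measurable_const.max (measurable_const.min
      stronglyMeasurable_condExp.measurable)).stronglyMeasurable
  have hW0 : ∀ i x, 0 ≤ W i x := fun i x => le_max_left _ _
  have hWN : ∀ i x, W i x ≤ N := fun i x => max_le hN0 (min_le_left _ _)
  have hWi : ∀ i, Integrable (W i) μ := fun i => integrable_condExp.congr (hWE i).symm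
  have hyi : ∀ i, Integrable (y i) μ := fun i => integrable_condExp.congr (hyE i).symm
  have ham : ∀ i, StronglyMeasurable[ℱ i] (a i) := fun i =>
    ((hαm i).mul (hWm i).measurable).stronglyMeasurable
  have ha0 : ∀ i x, 0 ≤ a i x := fun i x => mul_nonneg (hα0 i x) (hW0 i x)
  have hai : ∀ i, Integrable (a i) μ := fun i =>
    (hWi i).bdd_mul (c := A) ((hαm i).mono (ℱ.le i) le_rfl).aestronglyMeasurable
      (Filter.Eventually.of_forall fun x => by
        rw [Real.norm_of_nonneg (hα0 i x)]; exact hA i x)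
  have haB' : ∀ i x, a i x ≤ A * N := fun i x => mul_le_mul (hA i x) (hWN i x) (hW0 i x) hA0
  set B : ℝ := A * N + T.card * (A * N) with hB
  have hAN : 0 ≤ A * N := mul_nonneg hA0 hN0
  have haB : ∀ i x, a i x ≤ B := fun i x => (haB' i x).trans (by linarith)
  have hy0 : ∀ i x, 0 ≤ y i x := fun i x => le_max_left _ _
  have hyB : ∀ i x, y i x ≤ B := fun i x =>
    (max_le hBg0 (min_le_left _ _)).trans (by linarith)
  have hR : ∀ i, Integrable (∑ j ∈ T with i ≤ j, a j) μ := fun i =>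
    integrable_finsetSum' _ fun j _ => hai j
  -- the tower property
  have hpull : ∀ j, μ[fun x => α j x * w x|ℱ j] =ᵐ[μ] a j := by
    intro j
    have h1 : μ[α j * w|ℱ j] =ᵐ[μ] α j * μ[w|ℱ j] :=
      condExp_mul_of_stronglyMeasurable_left (hαm j).stronglyMeasurable (hαw j) hwi
    refine Filter.EventuallyEq.trans h1 ?_
    filter_upwards [hWE j] with x hx
    simp only [Pi.mul_apply, ha, hx]
  have htower : ∀ i, y i =ᵐ[μ] μ[∑ j ∈ T with i ≤ j, a j|ℱ i] := by
    intro i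
    refine (hyE i).trans ?_
    refine (condExp_finsetSum (fun j _ => hαw j) _).trans
      (Filter.EventuallyEq.trans ?_ (condExp_finsetSum (fun j _ => hai j) _).symm)
    have : ∀ᵐ x ∂μ, ∀ j ∈ T.filter (i ≤ ·),
        (μ[fun x => α j x * w x|ℱ i]) x = (μ[a j|ℱ i]) x := by
      refine (Filter.eventually_all_finset _).2 fun j hj => ?_
      have hij : i ≤ j := (Finset.mem_filter.1 hj).2
      have := hσ j
      exact (condExp_condExp_of_le (ℱ.mono hij) (ℱ.le j)).symm.trans (condExp_congr_ae (hpull j))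
    filter_upwards [this] with x hx
    simp only [Finset.sum_apply]
    exact Finset.sum_congr rfl hx
  have hay : ∀ i ∈ T, ∀ᵐ x ∂μ, a i x ≤ y i x := by
    intro i hi
    have := hσ i
    have h1 : μ[a i|ℱ i] ≤ᵐ[μ] μ[∑ j ∈ T with i ≤ j, a j|ℱ i] := by
      refine condExp_mono (hai i) (hR i) (Filter.Eventually.of_forall fun x => ?_)
      rw [Finset.sum_apply]
      exact Finset.single_le_sum (f := fun j => a j x) (fun j _ => ha0 j x)
        (Finset.mem_filter.2 ⟨hi, le_rfl⟩)
    rw [condExp_of_stronglyMeasurable (ℱ.le i) (ham i) (hai i)] at h1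
    filter_upwards [h1, htower i] with x h2 h3
    rw [h3]; exact h2
  have hkey : ∀ i ∈ T, ∀ f : Ω → ℝ, StronglyMeasurable[ℱ i] f → (∃ c, ∀ᵐ x ∂μ, ‖f x‖ ≤ c) →
      ∫ x, f x * ∑ j ∈ T with i ≤ j, a j x ∂μ = ∫ x, f x * y i x ∂μ := by
    intro i hi f hf ⟨c, hc⟩
    have := hσ i
    have hfR : Integrable (f * ∑ j ∈ T with i ≤ j, a j) μ :=
      (hR i).bdd_mul (hf.mono (ℱ.le i)).aestronglyMeasurable hc
    have h1 := condExp_mul_of_stronglyMeasurable_left hf hfR (hR i)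
    have h2 := integral_condExp (μ := μ) (f := f * ∑ j ∈ T with i ≤ j, a j) (ℱ.le i)
    have h3 : ∫ x, f x * ∑ j ∈ T with i ≤ j, a j x ∂μ
        = ∫ x, (f * ∑ j ∈ T with i ≤ j, a j) x ∂μ := by
      congr 1; ext x; simp
    rw [h3, ← h2]
    refine integral_congr_ae ?_
    filter_upwards [h1, htower i] with x h4 h5
    rw [h4, h5]; rfl
  have main := hcore Ω m0 μ ℱ T a y B ham ha0 haB hai hym hyi hy0 hyB hay hkey
  have hI1 := int_pow (μ := μ) T a B s hs ha0 haB hai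
  have hI2 : Integrable (fun x => ∑ i ∈ T, a i x * y i x ^ (s - 1)) μ :=
    integrable_finsetSum _ fun i _ =>
      int_ay _ _ B s hs (hai i) ((hym i).mono (ℱ.le i)).aestronglyMeasurable (hy0 i) (hyB i)
  have main' := ENNReal.ofReal_le_ofReal main
  rw [ENNReal.ofReal_mul hC.le, ofReal_integral_eq_lintegral_ofReal hI1
      (Filter.Eventually.of_forall fun x =>
        Real.rpow_nonneg (Finset.sum_nonneg fun i _ => ha0 i x) _),
    ofReal_integral_eq_lintegral_ofReal hI2 (Filter.Eventually.of_forall fun x =>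
      Finset.sum_nonneg fun i _ => mul_nonneg (ha0 i x) (Real.rpow_nonneg (hy0 i x) _))] at main'
  have hWall : ∀ᵐ x ∂μ, ∀ i, W i x = (μ[w|ℱ i]) x := ae_all_iff.2 hWE
  have hyall : ∀ᵐ x ∂μ, ∀ i, y i x = (μ[g i|ℱ i]) x := ae_all_iff.2 hyE
  refine Eq.trans_le ?_ (main'.trans_eq ?_)
  · refine lintegral_congr_ae ?_
    filter_upwards [hWall] with x hx
    rw [tsum_eq_sum (s := T) (fun i hi => by simp [hTz i hi])]
    simp only [ha, hx]
  · congr 1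
    refine lintegral_congr_ae ?_
    filter_upwards [hWall, hyall] with x hx hx'
    rw [tsum_eq_sum (s := T) (fun i hi => by simp [hTz i hi])]
    simp only [ha, hx, hx', hE, hg]
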